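/- Let G be a finite simple graph on n ≥ 1 vertices with list-chromatic number χ_ℓ(G), and let t be an integer with 1 ≤ t ≤ χ_ℓ(G). Then λ_t(G) > (6/7) · (t·n)/χ_ℓ(G). -/

import Mathlib

/-- `G` is `s`-choosable: every assignment of lists of `s` colors to the vertices
admits a proper coloring in which each vertex gets a color from its own list. -/
def Choosable {V : Type*} (G : SimpleGraph V) (s : ℕ) : Prop :=
  ∀ ℓ : V → Finset ℕ, (∀ v, (ℓ v).card = s) →
    ∃ c : V → ℕ, (∀ v, c v ∈ ℓ v) ∧ ∀ u w, G.Adj u w → c u ≠ c w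

/-- The maximum number of vertices of `G` colorable in a partial coloring from
the lists `ℓ` (a proper coloring of a subset of the vertices, each colored vertex
receiving a color from its own list). -/
noncomputable def maxColorable {V : Type*} (G : SimpleGraph V) (ℓ : V → Finset ℕ) : ℕ :=
  sSup { m | ∃ S : Finset V,
    (∃ c : V → ℕ, (∀ v ∈ S, c v ∈ ℓ v) ∧
      ∀ u ∈ S, ∀ w ∈ S, G.Adj u w → c u ≠ c w) ∧ S.card = m }

/-- `λ_t(G)`: the minimum over list assignments `ℓ` of size `t` of the maximum
number of vertices colorable in a partial coloring from `ℓ`. -/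
noncomputable def lambdaList {V : Type*} (G : SimpleGraph V) (t : ℕ) : ℕ :=
  sInf { m | ∃ ℓ : V → Finset ℕ, (∀ v, (ℓ v).card = t) ∧ maxColorable G ℓ = m }

/-- The list-chromatic number of `G`: the least `s` such that `G` is `s`-choosable. -/
noncomputable def listChromNum {V : Type*} (G : SimpleGraph V) : ℕ :=
  sInf { s | Choosable G s }

/-- The function `f_{s,t}(x) = 1 - x - (1 - (1 - x)/(s - t))^t`. -/
noncomputable def fst (s t : ℕ) (x : ℝ) : ℝ :=
  1 - x - (1 - (1 - x) / ((s : ℝ) - (t : ℝ))) ^ t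

/-- `log x ≥ (x - 1/x)/2` on `(0,1]`. -/
lemma aux_log_lower {x : ℝ} (h0 : 0 < x) (h1 : x ≤ 1) : (x - x⁻¹) / 2 ≤ Real.log x := by
  have hx : 0 ≤ Real.log x⁻¹ := Real.log_nonneg ((one_le_inv₀ h0).2 h1)
  have h := Real.self_le_sinh_iff.2 hx
  rw [Real.sinh_log (inv_pos.2 h0), Real.log_inv, inv_inv] at h
  linarith

/-- The key numerical inequality. -/
lemma aux_key {x : ℝ} (h0 : 1 / 7 < x) (h1 : x < 1) :
    -Real.log x < 7 * x * (1 - x) / (7 * x - 1) := by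
  have hx : 0 < x := by linarith
  have hw : 0 < 7 * x - 1 := by linarith
  by_cases hA : 0 < 7 * x ^ 2 - 6 * x + 1
  · have h := aux_log_lower hx h1.le
    have h2 : -((x - x⁻¹) / 2) < 7 * x * (1 - x) / (7 * x - 1) := by
      have e : -((x - x⁻¹) / 2) = (1 - x) * (1 + x) / (2 * x) := by
        field_simp; ring
      rw [e, div_lt_div_iff₀ (by positivity) hw]
      nlinarith [mul_pos (sub_pos.2 h1) hA]
    linarith
  · push Not at hA
    have hl : x < 0.64 := by nlinarith
    have hl' : 0.22 < x := by nlinarith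
    have hlog2 := Real.log_two_lt_d9
    have e : Real.log x = Real.log (2 * x) - Real.log 2 := by
      rw [Real.log_mul (by norm_num) hx.ne']; ring
    by_cases hB : x ≤ 1 / 2
    · have h := aux_log_lower (x := 2 * x) (by linarith) (by linarith)
      have h2 : 0.694 - ((2 * x - (2 * x)⁻¹) / 2) < 7 * x * (1 - x) / (7 * x - 1) := by
        have e : 0.694 - ((2 * x - (2 * x)⁻¹) / 2) = (2.776 * x + 1 - 4 * x ^ 2) / (4 * x) := by
          field_simp; ring
        rw [e, div_lt_div_iff₀ (by positivity) hw]
        nlinarith [mul_nonneg hx.le (sq_nonneg (x - 0.48)), sq_nonneg (x - 0.48)]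
      linarith
    · push Not at hB
      have h := Real.le_log_one_add_of_nonneg (x := 2 * x - 1) (by linarith)
      have e1 : 1 + (2 * x - 1) = 2 * x := by ring
      rw [e1] at h
      have h2 : 0.694 - 2 * (2 * x - 1) / (2 * x - 1 + 2) < 7 * x * (1 - x) / (7 * x - 1) := by
        have h3 : (2 * x - 1 + 2) ≠ 0 := by linarith
        rw [sub_lt_iff_lt_add, div_add_div _ _ hw.ne' h3, lt_div_iff₀ (mul_pos hw (by linarith))]
        nlinarith [mul_nonneg hx.le (sq_nonneg (x - 0.48)), sq_nonneg (x - 0.48)]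
      linarith

/-- The numerical inequality in terms of `s = t + m`. -/
lemma aux_num (t m : ℕ) (ht : 1 ≤ t) (hm : 1 ≤ m) :
    (6 / 7 : ℝ) * (t / (t + m)) <
      1 - (1 - (1 - (6 / 7 : ℝ) * (t / (t + m))) / m) ^ t := by
  have ht' : (0 : ℝ) < t := by exact_mod_cast ht
  have hm' : (1 : ℝ) ≤ m := by exact_mod_cast hm
  have hm0 : (0 : ℝ) < m := by linarith
  set α : ℝ := t / (t + m) with hα
  have ha0 : 0 < α := by positivity
  have ha1 : α < 1 := by rw [hα, div_lt_one (by positivity)]; linarith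
  set x : ℝ := 1 - 6 / 7 * α with hx
  have hx0 : 1 / 7 < x := by rw [hx]; linarith
  have hx1 : x < 1 := by rw [hx]; linarith
  have key := aux_key hx0 hx1
  have e : 7 * x * (1 - x) / (7 * x - 1) = x / m * t := by
    have h1 : 7 * x - 1 = 6 * (m / (t + m)) := by
      rw [hx, hα]; field_simp; ring
    have h2 : 1 - x = 6 / 7 * (t / (t + m)) := by rw [hx, hα]; ring
    rw [h1, h2]; field_simp
  rw [e] at key
  have hle : x / m ≤ 1 := by rw [div_le_one hm0]; linarith
  have h1 : (1 - x / m) ^ t ≤ Real.exp (-(x / m)) ^ t :=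
    pow_le_pow_left₀ (by linarith) (Real.one_sub_le_exp_neg _) t
  have h2 : Real.exp (-(x / m)) ^ t < x := by
    rw [← Real.exp_nat_mul, ← Real.lt_log_iff_exp_lt (by linarith)]
    linarith
  linarith

open Classical in
/-- Sum of product weights over a box. -/
lemma aux_box {N m : ℕ} (w : Option (Fin m) → ℝ) (A : Fin N → Finset (Option (Fin m))) :
    ∑ φ ∈ Fintype.piFinset A, ∏ c, w (φ c) = ∏ c, ∑ x ∈ A c, w x :=
  (Finset.prod_univ_sum A (fun _ x => w x)).symm

/-- The set of vertices colored according to `φ`. -/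
def AuxGood {V : Type*} (N m : ℕ) (ℓ : V → Finset ℕ) (f : V → ℕ)
    (φ : Fin N → Option (Fin m)) (v : V) (c : Fin N) : Prop :=
  (c : ℕ) ∈ ℓ v ∧ ((f v = c ∧ φ c = none) ∨ ∃ j : Fin m, f v = N + j ∧ φ c = some j)

lemma aux_maxColorable {V : Type*} [Fintype V] (G : SimpleGraph V) (ℓ : V → Finset ℕ)
    (S : Finset V) (c : V → ℕ) (h1 : ∀ v ∈ S, c v ∈ ℓ v)
    (h2 : ∀ u ∈ S, ∀ w ∈ S, G.Adj u w → c u ≠ c w) : S.card ≤ maxColorable G ℓ := by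
  apply le_csSup
  · refine ⟨Fintype.card V, ?_⟩
    rintro _ ⟨S, -, rfl⟩
    exact Finset.card_le_univ S
  · exact ⟨S, ⟨c, h1, h2⟩, rfl⟩

open Classical in
lemma aux_good_le {V : Type*} [Fintype V] (G : SimpleGraph V) (N m : ℕ) (ℓ : V → Finset ℕ)
    (f : V → ℕ) (hf : ∀ u w, G.Adj u w → f u ≠ f w) (φ : Fin N → Option (Fin m)) :
    (Finset.univ.filter (fun v => ∃ c, AuxGood N m ℓ f φ v c)).card ≤ maxColorable G ℓ := by
  refine aux_maxColorable G ℓ _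
    (fun v => if h : ∃ c, AuxGood N m ℓ f φ v c then (h.choose : ℕ) else 0) ?_ ?_
  · intro v hv
    have h := (Finset.mem_filter.1 hv).2
    simp only [dif_pos h]
    exact h.choose_spec.1
  · intro u hu w hw hadj
    have h := (Finset.mem_filter.1 hu).2
    have h' := (Finset.mem_filter.1 hw).2
    simp only [dif_pos h, dif_pos h']
    intro heq
    have heq' : h.choose = h'.choose := Fin.ext heq
    have s1 := h.choose_spec.2
    have s2 := h'.choose_spec.2
    rw [← heq'] at s2
    generalize h.choose = c at s1 s2
    apply hf u w hadj
    rcases s1 with ⟨a, b⟩ | ⟨j, a, b⟩ <;> rcases s2 with ⟨a', b'⟩ | ⟨j', a', b'⟩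
    · rw [a, a']
    · rw [b] at b'; cases b'
    · rw [b] at b'; cases b'
    · rw [b] at b'; cases b'; rw [a, a']

/-- Weights. -/
noncomputable def auxW (m : ℕ) (p : ℝ) : Option (Fin m) → ℝ
  | none => 1 - p
  | some _ => p / m

lemma auxW_sum (m : ℕ) (hm : 1 ≤ m) (p : ℝ) : ∑ x, auxW m p x = 1 := by
  have : (m : ℝ) ≠ 0 := by positivity
  rw [Fintype.sum_option]
  simp only [auxW, Finset.sum_const, Finset.card_univ, Fintype.card_fin, nsmul_eq_mul]
  field_simp; ring

lemma auxW_total (N m : ℕ) (hm : 1 ≤ m) (p : ℝ) :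
    ∑ φ : Fin N → Option (Fin m), ∏ c, auxW m p (φ c) = 1 := by
  classical
  have h := aux_box (N := N) (auxW m p) (fun _ => Finset.univ)
  rw [Fintype.piFinset_univ] at h
  rw [h]; simp [auxW_sum m hm p]

open Classical in
lemma aux_type1 {V : Type*} (N m : ℕ) (hm : 1 ≤ m) (p : ℝ) (hp0 : 0 ≤ p) (hp1 : p ≤ 1)
    (ℓ : V → Finset ℕ) (f : V → ℕ) (v : V) (hv : f v < N) (hvl : f v ∈ ℓ v) :
    1 - p ≤ ∑ φ : Fin N → Option (Fin m) with (∃ c, AuxGood N m ℓ f φ v c),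
      ∏ c, auxW m p (φ c) := by
  have h := aux_box (N := N) (auxW m p)
    (fun c => if c = ⟨f v, hv⟩ then {none} else Finset.univ)
  have h2 : ∏ c : Fin N, ∑ x ∈ (if c = ⟨f v, hv⟩ then ({none} : Finset (Option (Fin m)))
      else Finset.univ), auxW m p x = 1 - p := by
    rw [Finset.prod_eq_single ⟨f v, hv⟩]
    · simp [auxW]
    · intro b _ hb
      simp [hb, auxW_sum m hm p]
    · simp
  rw [← h2, ← h]
  apply Finset.sum_le_sum_of_subset_of_nonneg
  · intro φ hφ
    rw [Fintype.mem_piFinset] at hφ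
    have := hφ ⟨f v, hv⟩
    simp only [if_true, Finset.mem_singleton] at this
    simp only [Finset.mem_filter, Finset.mem_univ, true_and]
    exact ⟨⟨f v, hv⟩, hvl, Or.inl ⟨rfl, this⟩⟩
  · intro φ _ _
    apply Finset.prod_nonneg
    intro c _
    cases φ c with
    | none => simp only [auxW]; linarith
    | some j => simp only [auxW]; positivity

open Classical in
lemma aux_type2 {V : Type*} (N m t : ℕ) (hm : 1 ≤ m) (p : ℝ)
    (ℓ : V → Finset ℕ) (f : V → ℕ) (v : V) (j : Fin m) (hv : f v = N + j)
    (hN : ∀ c ∈ ℓ v, c < N) (ht : (ℓ v).card = t) :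
    1 - (1 - p / m) ^ t = ∑ φ : Fin N → Option (Fin m) with (∃ c, AuxGood N m ℓ f φ v c),
      ∏ c, auxW m p (φ c) := by
  have h := aux_box (N := N) (auxW m p)
    (fun c => if (c : ℕ) ∈ ℓ v then Finset.univ.erase (some j) else Finset.univ)
  have h2 : ∏ c : Fin N, ∑ x ∈ (if (c : ℕ) ∈ ℓ v then
      (Finset.univ.erase (some j) : Finset (Option (Fin m)))
      else Finset.univ), auxW m p x = (1 - p / m) ^ t := by
    have h3 : ∀ c : Fin N, ∑ x ∈ (if (c : ℕ) ∈ ℓ v then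
      (Finset.univ.erase (some j) : Finset (Option (Fin m)))
      else Finset.univ), auxW m p x = if (c : ℕ) ∈ ℓ v then 1 - p / m else 1 := by
      intro c
      split_ifs
      · rw [Finset.sum_erase_eq_sub (Finset.mem_univ _), auxW_sum m hm p]
        simp [auxW]
      · exact auxW_sum m hm p
    simp only [h3]
    rw [Finset.prod_ite]
    simp only [Finset.prod_const, one_pow, mul_one]
    congr 1
    rw [← ht, ← Finset.card_map Fin.valEmbedding]
    congr 1
    ext c
    simp only [Finset.mem_map, Finset.mem_filter, Finset.mem_univ, true_and,
      Fin.valEmbedding_apply]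
    constructor
    · rintro ⟨a, ha, rfl⟩; exact ha
    · intro hc; exact ⟨⟨c, hN c hc⟩, hc, rfl⟩
  rw [← h2, ← h, sub_eq_iff_eq_add, ← auxW_total N m hm p,
    ← Finset.sum_filter_add_sum_filter_not Finset.univ
      (fun φ : Fin N → Option (Fin m) => ∃ c, AuxGood N m ℓ f φ v c)]
  congr 1
  apply Finset.sum_congr _ (fun _ _ => rfl)
  ext φ
  simp only [Finset.mem_filter, Finset.mem_univ, true_and, Fintype.mem_piFinset, AuxGood,
    not_exists, not_and]
  refine forall_congr' fun c => ?_
  constructor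
  · intro hc
    split_ifs with hcl
    · rw [Finset.mem_erase]
      exact ⟨fun h => hc hcl (Or.inr ⟨j, hv, h⟩), Finset.mem_univ _⟩
    · exact Finset.mem_univ _
  · intro hc hcl
    rw [if_pos hcl, Finset.mem_erase] at hc
    rintro (⟨a, b⟩ | ⟨j', a, b⟩)
    · have := c.2; omega
    · have : j' = j := Fin.ext (by omega)
      exact hc.1 (this ▸ b)

lemma aux_main {V : Type*} [Fintype V] (G : SimpleGraph V)
    (hn : 1 ≤ Fintype.card V) (t m : ℕ) (ht : 1 ≤ t) (hm : 1 ≤ m)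
    (hG : Choosable G (t + m)) (ℓ : V → Finset ℕ) (hℓ : ∀ v, (ℓ v).card = t) :
    (6 / 7 : ℝ) * (t / (t + m)) * Fintype.card V < maxColorable G ℓ := by
  classical
  obtain ⟨N, hN⟩ : ∃ N, ∀ v, ∀ c ∈ ℓ v, c < N := by
    refine ⟨(Finset.univ.biUnion ℓ).sup id + 1, fun v c hc => ?_⟩
    have : c ∈ Finset.univ.biUnion ℓ := Finset.mem_biUnion.2 ⟨v, Finset.mem_univ _, hc⟩
    have := Finset.le_sup (f := id) this
    simp only [id] at this
    omega
  obtain ⟨f, hf1, hf2⟩ := hG (fun v => ℓ v ∪ Finset.Ico N (N + m)) (by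
    intro v
    rw [Finset.card_union_of_disjoint, hℓ, Nat.card_Ico]
    · omega
    · rw [Finset.disjoint_left]
      intro c hc hc'
      have := hN v c hc
      rw [Finset.mem_Ico] at hc'
      omega)
  have ht' : (0 : ℝ) < t := by exact_mod_cast ht
  have hm' : (1 : ℝ) ≤ m := by exact_mod_cast hm
  have hn' : (1 : ℝ) ≤ Fintype.card V := by exact_mod_cast hn
  set q : ℝ := (6 / 7 : ℝ) * (t / (t + m)) with hq
  have hα1 : (t : ℝ) / (t + m) < 1 := by rw [div_lt_one (by positivity)]; linarith
  have hα0 : 0 < (t : ℝ) / (t + m) := by positivity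
  by_cases hall : ∀ v, f v < N
  · have := aux_maxColorable G ℓ Finset.univ f (by
      intro v _
      rcases Finset.mem_union.1 (hf1 v) with h | h
      · exact h
      · have := hall v
        rw [Finset.mem_Ico] at h; omega) (fun u _ w _ => hf2 u w)
    rw [Finset.card_univ] at this
    have : (Fintype.card V : ℝ) ≤ maxColorable G ℓ := by exact_mod_cast this
    have : q < 1 := by linarith
    nlinarith
  · push Not at hall
    obtain ⟨v0, hv0⟩ := hall
    set p := 1 - q with hp
    have hp0 : 0 ≤ p := by linarith
    have hp1 : p ≤ 1 := by linarith
    have hnum : q < 1 - (1 - p / m) ^ t := aux_num t m ht hm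
    set P : V → ℝ := fun v => ∑ φ : Fin N → Option (Fin m) with (∃ c, AuxGood N m ℓ f φ v c),
      ∏ c, auxW m p (φ c) with hP
    have hbig : ∀ v, N ≤ f v → q < P v := by
      intro v hv
      have hlt : f v < N + m := by
        rcases Finset.mem_union.1 (hf1 v) with h | h
        · have := hN v _ h; omega
        · exact (Finset.mem_Ico.1 h).2
      have := aux_type2 N m t hm p ℓ f v ⟨f v - N, by omega⟩ (by simp only; omega) (hN v) (hℓ v)
      simp only [hP]
      rw [← this]; exact hnum
    have hle : ∀ v, q ≤ P v := by
      intro v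
      by_cases hv : f v < N
      · have hvl : f v ∈ ℓ v := by
          rcases Finset.mem_union.1 (hf1 v) with h | h
          · exact h
          · rw [Finset.mem_Ico] at h; omega
        have := aux_type1 N m hm p hp0 hp1 ℓ f v hv hvl
        simp only [hP]
        linarith
      · exact (hbig v (not_lt.1 hv)).le
    have hsum : ∑ _v : V, q < ∑ v, P v :=
      Finset.sum_lt_sum (fun v _ => hle v) ⟨v0, Finset.mem_univ _, hbig v0 hv0⟩
    have hub : ∑ v, P v ≤ maxColorable G ℓ := by
      simp only [hP, Finset.sum_filter]
      rw [Finset.sum_comm]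
      calc _ ≤ ∑ φ : Fin N → Option (Fin m),
            (∏ c, auxW m p (φ c)) * (maxColorable G ℓ : ℝ) := by
            apply Finset.sum_le_sum
            intro φ _
            rw [← Finset.sum_filter, Finset.sum_const, nsmul_eq_mul, mul_comm]
            apply mul_le_mul_of_nonneg_left
            · exact_mod_cast aux_good_le G N m ℓ f hf2 φ
            · apply Finset.prod_nonneg
              intro c _
              cases φ c with
              | none => simp only [auxW]; linarith
              | some j => simp only [auxW]; positivity
        _ = maxColorable G ℓ := by
            rw [← Finset.sum_mul, auxW_total N m hm p, one_mul]
    rw [Finset.sum_const, Finset.card_univ, nsmul_eq_mul] at hsum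
    linarith

theorem stmt4 {V : Type*} [Fintype V] (G : SimpleGraph V)
    (hn : 1 ≤ Fintype.card V) (t : ℕ) (ht : 1 ≤ t) (htl : t ≤ listChromNum G) :
    (6 / 7 : ℝ) * ((t : ℝ) * (Fintype.card V : ℝ)) / (listChromNum G : ℝ)
      < (lambdaList G t : ℝ) := by
  classical
  have hne : {s | Choosable G s}.Nonempty := by
    by_contra h
    rw [Set.not_nonempty_iff_eq_empty] at h
    unfold listChromNum at htl
    rw [h, Nat.sInf_empty] at htl
    omega
  have hG : Choosable G (listChromNum G) := Nat.sInf_mem hne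
  have hne2 : {m | ∃ ℓ : V → Finset ℕ, (∀ v, (ℓ v).card = t) ∧ maxColorable G ℓ = m}.Nonempty :=
    ⟨_, fun _ => Finset.range t, fun _ => Finset.card_range t, rfl⟩
  obtain ⟨ℓ, hℓ, hmax⟩ := Nat.sInf_mem hne2
  change _ = lambdaList G t at hmax
  rw [← hmax]
  generalize listChromNum G = s at *
  obtain ⟨m, rfl⟩ := Nat.exists_eq_add_of_le htl
  have ht' : (0 : ℝ) < t := by exact_mod_cast ht
  have hn' : (1 : ℝ) ≤ Fintype.card V := by exact_mod_cast hn
  rcases Nat.eq_zero_or_pos m with rfl | hm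
  · obtain ⟨f, hf1, hf2⟩ := hG ℓ hℓ
    have := aux_maxColorable G ℓ Finset.univ f (fun v _ => hf1 v) (fun u _ w _ => hf2 u w)
    rw [Finset.card_univ] at this
    have h1 : (Fintype.card V : ℝ) ≤ maxColorable G ℓ := by exact_mod_cast this
    have h2 : (6 / 7 : ℝ) * ((t : ℝ) * (Fintype.card V : ℝ)) / ((t + 0 : ℕ) : ℝ)
        = 6 / 7 * Fintype.card V := by
      rw [Nat.add_zero]; field_simp
    rw [h2]; linarith
  · have := aux_main G hn t m ht hm hG ℓ hℓ
    convert this using 1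
    push_cast
    ring
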